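/- For su(3), the 5-cocycle defined by Ω_{i_1 i_2 i_3 i_4 i_5} = f^j_{i_1[i_2} f^k_{i_3 i_4]} d_{jki_5} (antisymmetrization with unit weight over i_2, i_3, i_4, indices j,k summed) is dual to the structure constants: Ω_{i_1 i_2 i_3 i_4 i_5} = (1/(12√3)) ε_{i_1 i_2 i_3 i_4 i_5 i_6 i_7 i_8} f^{i_6 i_7 i_8}, where ε is the Levi-Civita symbol in 8 indices and the repeated indices i_6, i_7, i_8 are summed. -/

import Mathlib

open Matrix Complex

/-- The Gell-Mann matrices `λ₁, …, λ₈`. -/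
noncomputable def gellMann : Fin 8 → Matrix (Fin 3) (Fin 3) ℂ :=
  ![!![0, 1, 0; 1, 0, 0; 0, 0, 0],
    !![0, -Complex.I, 0; Complex.I, 0, 0; 0, 0, 0],
    !![1, 0, 0; 0, -1, 0; 0, 0, 0],
    !![0, 0, 1; 0, 0, 0; 1, 0, 0],
    !![0, 0, -Complex.I; 0, 0, 0; Complex.I, 0, 0],
    !![0, 0, 0; 0, 0, 1; 0, 1, 0],
    !![0, 0, 0; 0, 0, -Complex.I; 0, Complex.I, 0],
    ((Real.sqrt 3 : ℂ))⁻¹ • !![1, 0, 0; 0, 1, 0; 0, 0, -2]]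

/-- The `su(3)` structure constants `f_{abc} = (1/(4i)) Tr([λ_a,λ_b] λ_c)`. -/
noncomputable def fsu3 (a b c : Fin 8) : ℝ :=
  ((-Complex.I/4) * ((gellMann a * gellMann b - gellMann b * gellMann a) * gellMann c).trace).re

/-- The `su(3)` symmetric tensor `d_{abc} = (1/4) Tr({λ_a,λ_b} λ_c)`. -/
noncomputable def dsu3 (a b c : Fin 8) : ℝ :=
  ((1/4 : ℂ) * ((gellMann a * gellMann b + gellMann b * gellMann a) * gellMann c).trace).re

/-- The Levi-Civita symbol in 8 indices. -/
noncomputable def eps8 (v : Fin 8 → Fin 8) : ℝ :=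
  if h : Function.Bijective v then ((Equiv.Perm.sign (Equiv.ofBijective v h) : ℤ) : ℝ) else 0

/-- The `su(3)` five-cocycle `Ω_{i₁i₂i₃i₄i₅} = f^j_{i₁[i₂} f^k_{i₃i₄]} d_{jki₅}`
(unit-weight antisymmetrization over `i₂, i₃, i₄`). -/
noncomputable def omega5su3 (i : Fin 5 → Fin 8) : ℝ :=
  (6 : ℝ)⁻¹ * ∑ σ : Equiv.Perm (Fin 3), ((Equiv.Perm.sign σ : ℤ) : ℝ) *
    ∑ j, ∑ k,
      fsu3 (i 0) (i ((σ 0).succ.castSucc)) j *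
      fsu3 (i ((σ 1).succ.castSucc)) (i ((σ 2).succ.castSucc)) k *
      dsu3 j k (i 4)

/-- The Gell-Mann matrices with Gaussian integer entries: `λ₈` is rescaled by `√3`. -/
def gaussGellMann : Fin 8 → Matrix (Fin 3) (Fin 3) GaussianInt :=
  ![!![0, 1, 0; 1, 0, 0; 0, 0, 0],
    !![0, ⟨0, -1⟩, 0; ⟨0, 1⟩, 0, 0; 0, 0, 0],
    !![1, 0, 0; 0, -1, 0; 0, 0, 0],
    !![0, 0, 1; 0, 0, 0; 1, 0, 0],
    !![0, 0, ⟨0, -1⟩; 0, 0, 0; ⟨0, 1⟩, 0, 0],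
    !![0, 0, 0; 0, 0, 1; 0, 1, 0],
    !![0, 0, 0; 0, 0, ⟨0, -1⟩; 0, ⟨0, 1⟩, 0],
    !![1, 0, 0; 0, 1, 0; 0, 0, -2]]

/-- The factor between `gellMann` and `gaussGellMann`. -/
noncomputable def gellMannScale : Fin 8 → ℝ :=
  ![1, 1, 1, 1, 1, 1, 1, (Real.sqrt 3)⁻¹]

/-- The integers `3 * gellMannScale a ^ 2`. -/
def gellMannWeight : Fin 8 → ℤ :=
  ![3, 3, 3, 3, 3, 3, 3, 1]

/-- The integer structure constants of `gaussGellMann`. -/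
def intF (a b c : Fin 8) : ℤ :=
  (((gaussGellMann a * gaussGellMann b - gaussGellMann b * gaussGellMann a) *
    gaussGellMann c).trace).im

/-- The integer symmetric tensor of `gaussGellMann`. -/
def intD (a b c : Fin 8) : ℤ :=
  (((gaussGellMann a * gaussGellMann b + gaussGellMann b * gaussGellMann a) *
    gaussGellMann c).trace).re

theorem gellMann_eq_smul_map (a : Fin 8) :
    gellMann a = (gellMannScale a : ℂ) • (gaussGellMann a).map GaussianInt.toComplex := by
  fin_cases a <;> ext i j <;> fin_cases i <;> fin_cases j <;>
    simp [gellMann, gaussGellMann, gellMannScale, GaussianInt.toComplex_def]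

theorem trace_map_toComplex (M : Matrix (Fin 3) (Fin 3) GaussianInt) :
    (M.map GaussianInt.toComplex).trace = GaussianInt.toComplex M.trace :=
  (AddMonoidHom.map_trace GaussianInt.toComplex.toAddMonoidHom M).symm

theorem fsu3_eq (a b c : Fin 8) :
    fsu3 a b c = gellMannScale a * gellMannScale b * gellMannScale c * (intF a b c / 4) := by
  have h : (gellMann a * gellMann b - gellMann b * gellMann a) * gellMann c =
      ((gellMannScale a * gellMannScale b * gellMannScale c : ℝ) : ℂ) •
      ((gaussGellMann a * gaussGellMann b - gaussGellMann b * gaussGellMann a) *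
        gaussGellMann c).map GaussianInt.toComplex := by
    simp only [gellMann_eq_smul_map, ← RingHom.mapMatrix_apply, map_mul, map_sub, smul_mul_smul,
      mul_comm (gellMannScale b : ℂ) (gellMannScale a : ℂ), ← smul_sub, Complex.ofReal_mul]
  rw [fsu3, h, Matrix.trace_smul, trace_map_toComplex, intF, GaussianInt.intCast_im]
  simp
  ring

theorem dsu3_eq (a b c : Fin 8) :
    dsu3 a b c = gellMannScale a * gellMannScale b * gellMannScale c * (intD a b c / 4) := by
  have h : (gellMann a * gellMann b + gellMann b * gellMann a) * gellMann c =
      ((gellMannScale a * gellMannScale b * gellMannScale c : ℝ) : ℂ) •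
      ((gaussGellMann a * gaussGellMann b + gaussGellMann b * gaussGellMann a) *
        gaussGellMann c).map GaussianInt.toComplex := by
    simp only [gellMann_eq_smul_map, ← RingHom.mapMatrix_apply, map_mul, map_add, smul_mul_smul,
      mul_comm (gellMannScale b : ℂ) (gellMannScale a : ℂ), ← smul_add, Complex.ofReal_mul]
  rw [dsu3, h, Matrix.trace_smul, trace_map_toComplex, intD, GaussianInt.intCast_re]
  simp
  ring

theorem gellMannScale_sq (a : Fin 8) : gellMannScale a ^ 2 = (gellMannWeight a : ℝ) / 3 := by
  fin_cases a <;> simp [gellMannScale, gellMannWeight]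

theorem sum_intF_smul (a b : Fin 8) :
    ∑ j, ((gellMannWeight j * intF a b j : ℤ) : GaussianInt) • gaussGellMann j =
      (⟨0, -6⟩ : GaussianInt) • ⁅gaussGellMann a, gaussGellMann b⁆ := by
  revert a b
  decide +kernel

/-- The trace of the standard polynomial of degree four times a fifth matrix. -/
def standardTrace {R n : Type*} [CommRing R] [Fintype n] (a b c d e : Matrix n n R) : R :=
  ((⁅a, b⁆ * ⁅c, d⁆ + ⁅c, d⁆ * ⁅a, b⁆ + (⁅a, c⁆ * ⁅d, b⁆ + ⁅d, b⁆ * ⁅a, c⁆) +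
    (⁅a, d⁆ * ⁅b, c⁆ + ⁅b, c⁆ * ⁅a, d⁆)) * e).trace

section standardTrace

variable {R n : Type*} [CommRing R] [Fintype n] (a b c d e : Matrix n n R)

theorem standardTrace_swap₀₁ : standardTrace b a c d e = -standardTrace a b c d e := by
  rw [standardTrace, standardTrace, ← Matrix.trace_neg]
  congr 1
  simp only [Ring.lie_def]
  noncomm_ring

theorem standardTrace_swap₁₂ : standardTrace a c b d e = -standardTrace a b c d e := by
  rw [standardTrace, standardTrace, ← Matrix.trace_neg]
  congr 1
  simp only [Ring.lie_def]
  noncomm_ring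

theorem standardTrace_swap₂₃ : standardTrace a b d c e = -standardTrace a b c d e := by
  rw [standardTrace, standardTrace, ← Matrix.trace_neg]
  congr 1
  simp only [Ring.lie_def]
  noncomm_ring

theorem standardTrace_swap₃₄ : standardTrace a b c e d = -standardTrace a b c d e := by
  have h₁ (x y z : Matrix n n R) : (e * x * y * z * d).trace = (x * y * z * d * e).trace := by
    simp only [Matrix.mul_assoc, Matrix.trace_mul_comm e]
  have h₂ (x y z : Matrix n n R) : (x * e * y * z * d).trace = (y * z * d * x * e).trace := by
    simpa only [Matrix.mul_assoc] using Matrix.trace_mul_comm (x * e) (y * z * d)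
  have h₃ (x y z : Matrix n n R) : (x * y * e * z * d).trace = (z * d * x * y * e).trace := by
    simpa only [Matrix.mul_assoc] using Matrix.trace_mul_comm (x * y * e) (z * d)
  have h₄ (x y z : Matrix n n R) : (x * y * z * e * d).trace = (d * x * y * z * e).trace := by
    simpa only [Matrix.mul_assoc] using Matrix.trace_mul_comm (x * y * z * e) d
  simp only [standardTrace, Ring.lie_def, mul_sub, sub_mul, add_mul, Matrix.trace_add,
    Matrix.trace_sub, ← Matrix.mul_assoc, h₁, h₂, h₃, h₄]
  ring

end standardTrace

theorem trace_sum_smul_anticommutator {R n ι : Type*} [CommRing R] [Fintype n] [Fintype ι]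
    (G : ι → Matrix n n R) (E : Matrix n n R) (x y : ι → R) :
    (((∑ j, x j • G j) * (∑ k, y k • G k) + (∑ k, y k • G k) * (∑ j, x j • G j)) * E).trace =
      ∑ j, ∑ k, x j * y k * ((G j * G k + G k * G j) * E).trace := by
  have h : (∑ k, y k • G k) * (∑ j, x j • G j) = ∑ j, ∑ k, (x j * y k) • (G k * G j) := by
    rw [Finset.sum_mul_sum, Finset.sum_comm]
    simp only [Matrix.smul_mul, Matrix.mul_smul, smul_smul]
  rw [h, Finset.sum_mul_sum]
  simp only [Matrix.smul_mul, Matrix.mul_smul, smul_smul, mul_comm (y _) (x _),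
    ← Finset.sum_add_distrib, ← smul_add, Finset.sum_mul, Matrix.trace_sum, Matrix.trace_smul,
    smul_eq_mul]

theorem zsqrtd_re_sum {d : ℤ} {ι : Type*} (s : Finset ι) (g : ι → Zsqrtd d) :
    (∑ x ∈ s, g x).re = ∑ x ∈ s, (g x).re :=
  map_sum (AddMonoidHom.mk' Zsqrtd.re Zsqrtd.re_add) g s

theorem sum_sum_intF_mul_intD (a b c d e : Fin 8) :
    ∑ j, ∑ k, (gellMannWeight j * intF a b j) * (gellMannWeight k * intF c d k) * intD j k e =
      -36 * (((⁅gaussGellMann a, gaussGellMann b⁆ * ⁅gaussGellMann c, gaussGellMann d⁆ +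
        ⁅gaussGellMann c, gaussGellMann d⁆ * ⁅gaussGellMann a, gaussGellMann b⁆) *
          gaussGellMann e).trace).re := by
  set X := ⁅gaussGellMann a, gaussGellMann b⁆ with hX
  set Y := ⁅gaussGellMann c, gaussGellMann d⁆ with hY
  set z : GaussianInt := ⟨0, -6⟩ with hz
  have h : ((z • X * z • Y + z • Y * z • X) * gaussGellMann e).trace =
      ((-36 : ℤ) : GaussianInt) * ((X * Y + Y * X) * gaussGellMann e).trace := by
    rw [smul_mul_smul, smul_mul_smul, ← smul_add, Matrix.smul_mul, Matrix.trace_smul, smul_eq_mul]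
    rfl
  rw [← Zsqrtd.re_smul, ← h, hX, hY, hz, ← sum_intF_smul, ← sum_intF_smul]
  rw [trace_sum_smul_anticommutator, zsqrtd_re_sum]
  refine Finset.sum_congr rfl fun j _ => ?_
  rw [zsqrtd_re_sum]
  refine Finset.sum_congr rfl fun k _ => ?_
  rw [← Int.cast_mul, Zsqrtd.re_smul, intD]

theorem sum_sign_mul_perm_fin_three {R : Type*} [CommRing R] (g : Fin 3 → Fin 3 → Fin 3 → R) :
    ∑ σ : Equiv.Perm (Fin 3), ((Equiv.Perm.sign σ : ℤ) : R) * g (σ 0) (σ 1) (σ 2) =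
      g 0 1 2 + g 1 2 0 + g 2 0 1 - g 1 0 2 - g 0 2 1 - g 2 1 0 := by
  have h : (Finset.univ : Finset (Equiv.Perm (Fin 3))) =
      {1, finRotate 3, (finRotate 3)⁻¹, Equiv.swap 0 1, Equiv.swap 1 2, Equiv.swap 0 2} := by
    decide
  rw [h]
  repeat rw [Finset.sum_insert (by decide)]
  simp [Equiv.swap_apply_def, show (-1 : Fin 3) = 2 from rfl]
  ring

theorem sum_sum_fsu3_mul_dsu3 (a b c d e : Fin 8) :
    ∑ j, ∑ k, fsu3 a b j * fsu3 c d k * dsu3 j k e =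
      gellMannScale a * gellMannScale b * gellMannScale c * gellMannScale d * gellMannScale e *
      (-(1 / 16) * ((((⁅gaussGellMann a, gaussGellMann b⁆ * ⁅gaussGellMann c, gaussGellMann d⁆ +
        ⁅gaussGellMann c, gaussGellMann d⁆ * ⁅gaussGellMann a, gaussGellMann b⁆) *
          gaussGellMann e).trace).re : ℝ)) := by
  have h := congrArg (Int.cast : ℤ → ℝ) (sum_sum_intF_mul_intD a b c d e)
  push_cast at h
  have h' : ∀ x : ℝ, -(1 / 16) * x = (1 / 576) * (-36 * x) := fun x => by ring
  rw [h', ← h, Finset.mul_sum, Finset.mul_sum]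
  refine Finset.sum_congr rfl fun j _ => ?_
  rw [Finset.mul_sum, Finset.mul_sum]
  refine Finset.sum_congr rfl fun k _ => ?_
  have hj := gellMannScale_sq j
  have hk := gellMannScale_sq k
  rw [eq_div_iff (by norm_num)] at hj hk
  rw [fsu3_eq, fsu3_eq, dsu3_eq, ← hj, ← hk]
  ring

theorem omega5su3_eq (i : Fin 5 → Fin 8) :
    omega5su3 i = (∏ x, gellMannScale (i x)) * (-(1 / 48) *
      ((standardTrace (gaussGellMann (i 0)) (gaussGellMann (i 1)) (gaussGellMann (i 2))
        (gaussGellMann (i 3)) (gaussGellMann (i 4))).re : ℝ)) := by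
  rw [omega5su3, sum_sign_mul_perm_fin_three fun x y z => ∑ j, ∑ k,
    fsu3 (i 0) (i x.succ.castSucc) j * fsu3 (i y.succ.castSucc) (i z.succ.castSucc) k *
      dsu3 j k (i 4)]
  have h₁ : (0 : Fin 3).succ.castSucc = 1 := rfl
  have h₂ : (1 : Fin 3).succ.castSucc = 2 := rfl
  have h₃ : (2 : Fin 3).succ.castSucc = 3 := rfl
  have hs (a b : Fin 8) :
      ⁅gaussGellMann a, gaussGellMann b⁆ = -⁅gaussGellMann b, gaussGellMann a⁆ :=
    (neg_sub _ _).symm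
  simp only [h₁, h₂, h₃, sum_sum_fsu3_mul_dsu3, standardTrace, Fin.prod_univ_five, add_mul,
    Matrix.trace_add, Zsqrtd.re_add, Int.cast_add, hs (i 3) (i 2), hs (i 2) (i 1), hs (i 1) (i 3),
    neg_mul, mul_neg, Matrix.trace_neg, Zsqrtd.re_neg, Int.cast_neg]
  ring

theorem eps8_comp_perm (v : Fin 8 → Fin 8) (τ : Equiv.Perm (Fin 8)) :
    eps8 (v ∘ τ) = ((Equiv.Perm.sign τ : ℤ) : ℝ) * eps8 v := by
  unfold eps8
  by_cases h : Function.Bijective v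
  · have h' : Function.Bijective (v ∘ τ) := h.comp τ.bijective
    have : Equiv.ofBijective (v ∘ τ) h' = Equiv.ofBijective v h * τ := by ext; simp
    rw [dif_pos h, dif_pos h', this]
    simp [mul_comm]
  · have h' : ¬ Function.Bijective (v ∘ τ) := fun H => h ((τ.bijective_comp v).1 H)
    rw [dif_neg h, dif_neg h', mul_zero]

theorem eps8_append_comp (i : Fin 5 → Fin 8) (j : Fin 3 → Fin 8) (σ : Equiv.Perm (Fin 5)) :
    eps8 (Fin.append (i ∘ σ) j) = ((Equiv.Perm.sign σ : ℤ) : ℝ) * eps8 (Fin.append i j) := by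
  have h : Fin.append (i ∘ σ) j =
      Fin.append i j ∘
        finSumFinEquiv.permCongr (Equiv.Perm.sumCongr σ (1 : Equiv.Perm (Fin 3))) := by
    funext x
    refine Fin.addCases (fun y => ?_) (fun y => ?_) x <;>
      simp [Equiv.permCongr_apply, finSumFinEquiv_symm_apply_castAdd (n := 3),
        finSumFinEquiv_symm_apply_natAdd (m := 5), finSumFinEquiv_apply_left (n := 3),
        finSumFinEquiv_apply_right (m := 5)]
  rw [h, eps8_comp_perm (Fin.append i j)]
  congr 3
  exact (Equiv.Perm.sign_permCongr _ _).trans (by simp [Equiv.Perm.sign_sumCongr])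

/-- The sign of the permutation sorting a list; zero if an entry is repeated. -/
def sortSign {n : ℕ} : List (Fin n) → ℤ
  | [] => 1
  | x :: l => (l.map fun y => if x < y then 1 else if y < x then -1 else 0).prod * sortSign l

theorem eps8_eq_prod (v : Fin 8 → Fin 8) :
    eps8 v = ((∏ x, ∏ y ∈ Finset.Ioi x,
      if v x < v y then 1 else if v y < v x then -1 else 0 : ℤ) : ℝ) := by
  unfold eps8
  split_ifs with h
  · rw [Equiv.Perm.sign_eq_prod_prod_Ioi]
    push_cast
    refine Finset.prod_congr rfl fun x _ => Finset.prod_congr rfl fun y hy => ?_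
    have hne : v x ≠ v y := fun e => (Finset.mem_Ioi.1 hy).ne (h.1 e)
    rcases hne.lt_or_gt with hlt | hlt <;> simp [hlt, hlt.not_gt]
  · rw [Finite.injective_iff_bijective.symm, Function.Injective] at h
    push Not at h
    obtain ⟨x, y, hxy, hne⟩ := h
    symm
    rw [Int.cast_eq_zero]
    wlog hlt : x < y generalizing x y
    · exact this y x hxy.symm hne.symm (lt_of_le_of_ne (not_lt.1 hlt) hne.symm)
    exact Finset.prod_eq_zero (Finset.mem_univ x)
      (Finset.prod_eq_zero (Finset.mem_Ioi.2 hlt) (by simp [hxy]))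

theorem prod_prod_Ioi_eq_sortSign {m n : ℕ} (v : Fin n → Fin m) :
    (∏ x, ∏ y ∈ Finset.Ioi x, if v x < v y then 1 else if v y < v x then -1 else 0) =
      sortSign (List.ofFn v) := by
  induction n with
  | zero => simp [sortSign]
  | succ n ih =>
    simp only [Fin.prod_univ_succ, Fin.prod_Ioi_zero, Fin.prod_Ioi_succ, List.ofFn_succ, sortSign,
      List.map_ofFn, List.prod_ofFn, Function.comp_apply, ih fun x => v x.succ]

theorem eps8_eq_sortSign (v : Fin 8 → Fin 8) : eps8 v = (sortSign (List.ofFn v) : ℝ) := by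
  rw [eps8_eq_prod, prod_prod_Ioi_eq_sortSign]

/-- The integers `(gellMannScale a ^ 2)⁻¹`. -/
def gellMannNormSq : Fin 8 → ℤ :=
  ![1, 1, 1, 1, 1, 1, 1, 3]

theorem gellMannNormSq_mul_sq (a : Fin 8) :
    (gellMannNormSq a : ℝ) * gellMannScale a ^ 2 = 1 := by
  fin_cases a <;> simp [gellMannScale, gellMannNormSq]

theorem prod_gellMannScale : ∏ a, gellMannScale a = (√3)⁻¹ := by
  simp [Fin.prod_univ_eight, gellMannScale]

theorem eps8_append_mul_fsu3 (i : Fin 5 → Fin 8) (j : Fin 3 → Fin 8) :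
    1 / (12 * √3) * (eps8 (Fin.append i j) * fsu3 (j 0) (j 1) (j 2)) =
      (∏ x, gellMannScale (i x)) * (1 / 144 * ((∏ x, gellMannNormSq (i x) : ℤ) *
        (eps8 (Fin.append i j) * intF (j 0) (j 1) (j 2)))) := by
  by_cases h : Function.Bijective (Fin.append i j)
  · have hs : (∏ x, gellMannScale (i x)) *
        (gellMannScale (j 0) * gellMannScale (j 1) * gellMannScale (j 2)) = (√3)⁻¹ := by
      rw [← prod_gellMannScale, ← h.prod_comp gellMannScale, Fin.prod_univ_add]
      simp [Fin.prod_univ_three]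
    have hn : ((∏ x, gellMannNormSq (i x) : ℤ) : ℝ) * (∏ x, gellMannScale (i x)) ^ 2 = 1 := by
      push_cast
      rw [← Finset.prod_pow, ← Finset.prod_mul_distrib]
      exact Finset.prod_eq_one fun x _ => gellMannNormSq_mul_sq _
    have h3 : (√3)⁻¹ ^ 2 = (1 / 3 : ℝ) := by simp
    rw [fsu3_eq]
    generalize gellMannScale (j 0) * gellMannScale (j 1) * gellMannScale (j 2) = t at *
    generalize ∏ x, gellMannScale (i x) = u at *
    generalize ((∏ x, gellMannNormSq (i x) : ℤ) : ℝ) = n at *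
    generalize (eps8 (Fin.append i j)) = E
    rw [one_div, mul_inv]
    generalize (√3)⁻¹ = r at *
    have ht : r * t = n * u / 3 := by
      linear_combination -(r * t) * hn + r * n * u * hs + n * u * h3
    linear_combination (E * intF (j 0) (j 1) (j 2) / 48) * ht
  · rw [show eps8 (Fin.append i j) = 0 from dif_neg h]
    simp

/-- The index triples on which `intF` does not vanish. -/
def intFSupport : List (Fin 3 → Fin 8) :=
  [![0, 1, 2], ![0, 3, 6], ![0, 4, 5], ![1, 3, 5], ![1, 4, 6], ![2, 3, 4], ![2, 5, 6], ![3, 4, 7],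
    ![5, 6, 7]].flatMap fun t =>
      [![t 0, t 1, t 2], ![t 1, t 2, t 0], ![t 2, t 0, t 1],
        ![t 1, t 0, t 2], ![t 0, t 2, t 1], ![t 2, t 1, t 0]]

theorem intFSupport_nodup : intFSupport.Nodup := by
  decide +kernel

theorem mem_intFSupport_of_ne_zero (p q r : Fin 8) (h : intF p q r ≠ 0) :
    ![p, q, r] ∈ intFSupport := by
  revert p q r
  decide +kernel

theorem sum_mul_intF {R : Type*} [CommRing R] (g : (Fin 3 → Fin 8) → R) :
    ∑ j, g j * intF (j 0) (j 1) (j 2) =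
      (intFSupport.map fun j => g j * intF (j 0) (j 1) (j 2)).sum := by
  rw [← List.sum_toFinset _ intFSupport_nodup]
  refine (Finset.sum_subset (Finset.subset_univ _) fun j _ hj => ?_).symm
  have h0 : intF (j 0) (j 1) (j 2) = 0 := by
    by_contra h
    refine hj (List.mem_toFinset.2 ?_)
    convert mem_intFSupport_of_ne_zero _ _ _ h
    ext x
    fin_cases x <;> rfl
  simp [h0]

theorem standardTrace_eq_of_lt : ∀ a b : Fin 8, a < b → ∀ c, b < c → ∀ d, c < d → ∀ e, d < e →
    -3 * (standardTrace (gaussGellMann a) (gaussGellMann b) (gaussGellMann c)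
      (gaussGellMann d) (gaussGellMann e)).re =
    (gellMannNormSq a * gellMannNormSq b * gellMannNormSq c * gellMannNormSq d * gellMannNormSq e) *
      (intFSupport.map fun j => sortSign [a, b, c, d, e, j 0, j 1, j 2] *
        intF (j 0) (j 1) (j 2)).sum := by
  decide +kernel

theorem omega5su3_comp_swap (i : Fin 5 → Fin 8) (k : Fin 4) :
    omega5su3 (i ∘ Equiv.swap k.castSucc k.succ) = -omega5su3 i := by
  rw [omega5su3_eq, omega5su3_eq, Function.comp_def,
    Equiv.prod_comp (Equiv.swap k.castSucc k.succ) fun x => gellMannScale (i x)]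
  fin_cases k
  · simp [Equiv.swap_apply_def, standardTrace_swap₀₁ (gaussGellMann (i 0)),
      -GaussianInt.intCast_re]
  · simp [Equiv.swap_apply_def, standardTrace_swap₁₂ _ (gaussGellMann (i 1)),
      -GaussianInt.intCast_re]
  · simp [Equiv.swap_apply_def, standardTrace_swap₂₃ _ _ (gaussGellMann (i 2)),
      -GaussianInt.intCast_re]
  · simp [Equiv.swap_apply_def, standardTrace_swap₃₄ _ _ _ (gaussGellMann (i 3)),
      -GaussianInt.intCast_re]

theorem omega5su3_comp_perm (i : Fin 5 → Fin 8) (σ : Equiv.Perm (Fin 5)) :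
    omega5su3 (i ∘ σ) = ((Equiv.Perm.sign σ : ℤ) : ℝ) * omega5su3 i := by
  have hσ : σ ∈ Submonoid.closure
      (Set.range fun k : Fin 4 => Equiv.swap k.castSucc k.succ) := by
    simp [Equiv.Perm.mclosure_swap_castSucc_succ]
  induction hσ using Submonoid.closure_induction generalizing i with
  | mem τ hτ =>
    obtain ⟨k, rfl⟩ := hτ
    simp [omega5su3_comp_swap, Equiv.Perm.sign_swap k.castSucc_lt_succ.ne]
  | one => simp
  | mul τ ρ _ _ hτ hρ =>
    rw [Equiv.Perm.coe_mul, ← Function.comp_assoc, hρ, hτ]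
    simp only [Equiv.Perm.sign_mul, Units.val_mul, Int.cast_mul]
    ring

theorem eq_zero_of_comp_perm_of_strictMono {n : ℕ} {α : Type*} [LinearOrder α]
    {D : (Fin n → α) → ℝ}
    (hD : ∀ i (σ : Equiv.Perm (Fin n)), D (i ∘ σ) = ((Equiv.Perm.sign σ : ℤ) : ℝ) * D i)
    (h : ∀ i, StrictMono i → D i = 0) (i : Fin n → α) : D i = 0 := by
  by_cases hi : Function.Injective i
  · have h0 := h _ ((Tuple.monotone_sort i).strictMono_of_injective
      (hi.comp (Tuple.sort i).injective))
    rw [hD] at h0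
    exact (mul_eq_zero.1 h0).resolve_left (by simp)
  · simp only [Function.Injective, not_forall] at hi
    obtain ⟨x, y, hxy, hne⟩ := hi
    have hs : i ∘ Equiv.swap x y = i := by
      funext z
      rw [Function.comp_apply, Equiv.swap_apply_def]
      split_ifs with h₁ h₂ <;> simp [*]
    have h1 := hD i (Equiv.swap x y)
    rw [hs, Equiv.Perm.sign_swap hne] at h1
    push_cast at h1
    linarith

theorem omega5su3_eq_of_strictMono (i : Fin 5 → Fin 8) (hi : StrictMono i) :
    omega5su3 i = (1 / (12 * √3)) *
      ∑ j : Fin 3 → Fin 8, eps8 (Fin.append i j) * fsu3 (j 0) (j 1) (j 2) := by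
  have h := congrArg (Int.cast : ℤ → ℝ) <| standardTrace_eq_of_lt (i 0) (i 1) (hi (by decide))
    (i 2) (hi (by decide)) (i 3) (hi (by decide)) (i 4) (hi (by decide))
  have hl (j : Fin 3 → Fin 8) : List.ofFn (Fin.append i j : Fin 8 → Fin 8) =
      [i 0, i 1, i 2, i 3, i 4, j 0, j 1, j 2] := rfl
  rw [Finset.mul_sum]
  simp only [eps8_append_mul_fsu3]
  rw [← Finset.mul_sum, ← Finset.mul_sum, ← Finset.mul_sum, omega5su3_eq]
  congr 1
  simp only [eps8_eq_sortSign, hl]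
  have hsum := sum_mul_intF fun j => sortSign [i 0, i 1, i 2, i 3, i 4, j 0, j 1, j 2]
  simp only [Int.cast_id] at hsum
  rw [← hsum] at h
  rw [Fin.prod_univ_five]
  simp only [← Int.cast_mul, ← Int.cast_sum]
  rw [← h]
  push_cast
  ring

/-- the `su(3)` five-cocycle is dual to the structure constants:
`Ω_{i₁…i₅} = (1/(12√3)) ε_{i₁…i₅i₆i₇i₈} f^{i₆i₇i₈}` (sum over `i₆, i₇, i₈`). -/
theorem stmt16 :
    ∀ i : Fin 5 → Fin 8,
      omega5su3 i = (1/(12 * Real.sqrt 3)) *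
        ∑ j : Fin 3 → Fin 8, eps8 (Fin.append i j) * fsu3 (j 0) (j 1) (j 2) := by
  intro i
  refine sub_eq_zero.1 (eq_zero_of_comp_perm_of_strictMono (D := fun i => omega5su3 i -
    1 / (12 * √3) * ∑ j : Fin 3 → Fin 8, eps8 (Fin.append i j) * fsu3 (j 0) (j 1) (j 2))
    (fun i σ => ?_) (fun i hi => sub_eq_zero.2 (omega5su3_eq_of_strictMono i hi)) i)
  simp only [omega5su3_comp_perm, eps8_append_comp, mul_assoc, ← Finset.mul_sum]
  ring
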